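/- arXiv:1812.02388 — 3 statements merged into one kernel-verified Lean document; each statement's English description precedes it below -/
import Mathlib

section
/- For integers $1 \le \sigma \le K$, the function $f(n) = \binom{\sigma}{n}/\binom{K}{n}$ is discrete convex on $\{1,\dots,K\}$: for all integers $n$ with $2 \le n \le K-1$, one has $\frac{\binom{\sigma}{n+1}}{\binom{K}{n+1}} + \frac{\binom{\sigma}{n-1}}{\binom{K}{n-1}} \ge 2\,\frac{\binom{\sigma}{n}}{\binom{K}{n}}$ as real numbers. -/
theorem Nat.cast_choose_succ_mul (N m : ℕ) :
    (N.choose (m + 1) : ℝ) * (m + 1) = N.choose m * ((N : ℝ) - m) := by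
  rcases le_or_gt m N with h | h
  · have := Nat.choose_succ_right_eq N m
    rw [← Nat.cast_sub h]
    exact_mod_cast this
  · simp [Nat.choose_eq_zero_of_lt h, Nat.choose_eq_zero_of_lt (h.trans m.lt_succ_self)]

theorem choose_ratio_succ (K σ m : ℕ) :
    (σ.choose (m + 1) : ℝ) / K.choose (m + 1) =
      (σ.choose m : ℝ) / K.choose m * (((σ : ℝ) - m) / ((K : ℝ) - m)) := by
  have hm1 : (m : ℝ) + 1 ≠ 0 := by positivity
  rw [← mul_div_mul_right _ _ hm1, Nat.cast_choose_succ_mul, Nat.cast_choose_succ_mul,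
    div_mul_div_comm]

/-- For integers `1 ≤ σ ≤ K`, the function `f(n) = C(σ,n)/C(K,n)` is discrete convex on
`{1,…,K}`: for all integers `n` with `2 ≤ n ≤ K-1`,
`C(σ,n+1)/C(K,n+1) + C(σ,n-1)/C(K,n-1) ≥ 2 C(σ,n)/C(K,n)` as real numbers. -/
theorem choose_ratio_discrete_convex (K σ : ℕ) (hσ1 : 1 ≤ σ) (hσ2 : σ ≤ K) :
    ∀ n : ℕ, 2 ≤ n → n ≤ K - 1 →
      2 * ((σ.choose n : ℝ) / (K.choose n : ℝ)) ≤
        (σ.choose (n + 1) : ℝ) / (K.choose (n + 1) : ℝ) +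
          (σ.choose (n - 1) : ℝ) / (K.choose (n - 1) : ℝ) := by
  intro n hn hnK
  obtain ⟨m, rfl⟩ : ∃ m, n = m + 1 := ⟨n - 1, by omega⟩
  have hu : (0 : ℝ) < (K : ℝ) - m - 1 := by
    have h : ((m + 1 : ℕ) : ℝ) < K := Nat.cast_lt.2 (by omega)
    push_cast at h
    linarith
  have hu' : (0 : ℝ) < (K : ℝ) - m := by linarith
  have hd : (0 : ℝ) ≤ ((K : ℝ) - σ) * ((K : ℝ) - σ - 1) := by
    obtain ⟨d, rfl⟩ := Nat.exists_eq_add_of_le hσ2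
    rcases d with _ | d
    · simp
    · push_cast
      have : (0 : ℝ) ≤ (d + 1) * d := by positivity
      linarith
  rw [choose_ratio_succ K σ (m + 1), choose_ratio_succ K σ m, Nat.add_sub_cancel, ← sub_nonneg]
  push_cast
  rw [← sub_sub (K : ℝ), ← sub_sub (σ : ℝ)]
  have ha : (0 : ℝ) ≤ (σ.choose m : ℝ) / K.choose m := by positivity
  have h := mul_nonneg ha (div_nonneg hd (mul_pos hu' hu).le)
  generalize (σ.choose m : ℝ) / K.choose m = a at h ⊢
  refine h.trans_eq ?_
  have := hu.ne'
  have := hu'.ne'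
  field_simp
  ring
end

section
/- Let $1 \le \sigma \le K_T$ and let $t$ be an integer with $1 \le t \le K_T$. The minimum of $\sum_{n=1}^{K_T} \alpha_n \binom{\sigma}{n}/\binom{K_T}{n}$ over all real weights $\alpha_1,\dots,\alpha_{K_T} \ge 0$ satisfying $\sum_{n=1}^{K_T} \alpha_n = 1$ and $\sum_{n=1}^{K_T} n\,\alpha_n = t$ equals $\binom{\sigma}{t}/\binom{K_T}{t}$; i.e., $\binom{\sigma}{t}/\binom{K_T}{t}$ is a lower bound for the objective on the feasible set and is attained (by $\alpha_t = 1$, all other weights zero). -/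
open Finset

/-- A sequence with monotone increments lies above its supporting lines. -/
theorem supporting_line_le_of_monotone_increments {f : ℕ → ℝ}
    (hf : Monotone fun n => f (n + 1) - f n) (t n : ℕ) :
    f t + ((n : ℝ) - t) * (f (t + 1) - f t) ≤ f n := by
  rcases le_total t n with h | h
  · induction n, h using Nat.le_induction with
    | base => simp
    | succ n h ih =>
      have h1 : f (t + 1) - f t ≤ f (n + 1) - f n := hf h
      push_cast
      linarith
  · induction t, h using Nat.le_induction with
    | base => simp
    | succ t h ih =>
      have h1 : f (t + 1) - f t ≤ f (t + 1 + 1) - f (t + 1) := hf t.le_succ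
      have h2 : (n : ℝ) ≤ t := by exact_mod_cast h
      push_cast
      nlinarith

theorem choose_div_choose_succ_mul {K σ n : ℕ} (hn : n < K) :
    ((σ.choose (n + 1) : ℝ) / K.choose (n + 1)) * ((K : ℝ) - n) =
      ((σ.choose n : ℝ) / K.choose n) * ((σ : ℝ) - n) := by
  rcases lt_or_ge σ n with h | h
  · simp [Nat.choose_eq_zero_of_lt h, Nat.choose_eq_zero_of_lt (h.trans n.lt_succ_self)]
  have h1 : (σ.choose (n + 1) : ℝ) * (n + 1) = σ.choose n * ((σ : ℝ) - n) := by
    rw [← Nat.cast_sub h]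
    exact_mod_cast Nat.choose_succ_right_eq σ n
  have h2 : (K.choose (n + 1) : ℝ) * (n + 1) = K.choose n * ((K : ℝ) - n) := by
    rw [← Nat.cast_sub hn.le]
    exact_mod_cast Nat.choose_succ_right_eq K n
  have h3 : (K.choose n : ℝ) ≠ 0 := by exact_mod_cast (Nat.choose_pos hn.le).ne'
  have h4 : (K.choose (n + 1) : ℝ) ≠ 0 := by exact_mod_cast (Nat.choose_pos hn).ne'
  have h5 : (n : ℝ) + 1 ≠ 0 := by positivity
  rw [div_mul_eq_mul_div, div_mul_eq_mul_div, div_eq_div_iff h4 h3, ← h1]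
  linear_combination -(σ.choose (n + 1) : ℝ) * h2

theorem monotone_increments_choose_div_choose {K σ : ℕ} (hσ : σ < K) :
    Monotone fun n : ℕ => (σ.choose (n + 1) : ℝ) / K.choose (n + 1) -
      (σ.choose n : ℝ) / K.choose n := by
  refine monotone_nat_of_le_succ fun n => ?_
  have hpos : ∀ m : ℕ, 0 ≤ (σ.choose m : ℝ) / K.choose m := fun m => by positivity
  rcases le_or_gt σ n with h | h
  · have h1 : (σ.choose (n + 1) : ℝ) / K.choose (n + 1) = 0 := by
      simp [Nat.choose_eq_zero_of_lt (Nat.lt_succ_of_le h)]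
    linarith [hpos n, hpos (n + 1 + 1)]
  have h1 := choose_div_choose_succ_mul (σ := σ) (h.trans hσ)
  have h2 := choose_div_choose_succ_mul (K := K) (σ := σ) (n := n + 1) (by omega)
  have hb : (σ : ℝ) + 1 ≤ K := by exact_mod_cast hσ
  have ha : (n : ℝ) + 1 ≤ σ := by exact_mod_cast h
  have hp := hpos (n + 1)
  push_cast at h2
  generalize (σ.choose n : ℝ) / K.choose n = x at *
  generalize (σ.choose (n + 1) : ℝ) / K.choose (n + 1) = y at *
  generalize (σ.choose (n + 1 + 1) : ℝ) / K.choose (n + 1 + 1) = z at *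
  have hy : (y - z) * ((K : ℝ) - (n + 1)) = y * (K - σ) := by linear_combination -h2
  have hyz : 0 ≤ y - z := by
    refine nonneg_of_mul_nonneg_left (b := (K : ℝ) - (n + 1)) ?_ (by linarith)
    rw [hy]
    exact mul_nonneg hp (by linarith)
  have hxy : (y - z) * ((σ : ℝ) - n) ≤ (x - y) * (σ - n) := by nlinarith
  linarith [le_of_mul_le_mul_right hxy (by linarith)]

theorem exists_supporting_slope_choose_div_choose {K σ t : ℕ} (hσ : σ ≤ K) (ht : t ≤ K) :
    ∃ s : ℝ, ∀ n ≤ K, (σ.choose t : ℝ) / K.choose t + ((n : ℝ) - t) * s ≤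
      (σ.choose n : ℝ) / K.choose n := by
  rcases hσ.eq_or_lt with rfl | h
  · refine ⟨0, fun n hn => ?_⟩
    have hone : ∀ m ≤ σ, (σ.choose m : ℝ) / σ.choose m = 1 := fun m hm =>
      div_self (by exact_mod_cast (Nat.choose_pos hm).ne')
    simp [hone n hn, hone t ht]
  · exact ⟨_, fun n _ => supporting_line_le_of_monotone_increments
      (f := fun n => (σ.choose n : ℝ) / K.choose n)
      (monotone_increments_choose_div_choose h) t n⟩

/-- Let `1 ≤ σ ≤ K_T` and `1 ≤ t ≤ K_T` be integers. The minimum of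
`∑ₙ αₙ C(σ,n)/C(K_T,n)` over nonnegative weights `α₁,…,α_{K_T}` with `∑ αₙ = 1` and
`∑ n αₙ = t` equals `C(σ,t)/C(K_T,t)`: it is a lower bound on the feasible set and is
attained (by `α_t = 1`, all other weights zero). -/
theorem placement_opt_integer (KT σ t : ℕ) (hσ1 : 1 ≤ σ) (hσ2 : σ ≤ KT)
    (ht1 : 1 ≤ t) (ht2 : t ≤ KT) :
    IsLeast {x : ℝ | ∃ α : ℕ → ℝ,
        (∀ n ∈ Finset.Icc 1 KT, 0 ≤ α n) ∧
        (∑ n ∈ Finset.Icc 1 KT, α n) = 1 ∧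
        (∑ n ∈ Finset.Icc 1 KT, (n : ℝ) * α n) = (t : ℝ) ∧
        x = ∑ n ∈ Finset.Icc 1 KT, α n * ((σ.choose n : ℝ) / (KT.choose n : ℝ))}
      ((σ.choose t : ℝ) / (KT.choose t : ℝ)) := by
  constructor
  · refine ⟨fun n => if n = t then 1 else 0, fun n _ => by positivity, ?_, ?_, ?_⟩ <;>
      simp [ht1, ht2]
  · rintro x ⟨α, hα, hsum, hmean, rfl⟩
    obtain ⟨s, hs⟩ := exists_supporting_slope_choose_div_choose hσ2 ht2
    calc (σ.choose t : ℝ) / KT.choose t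
        = ∑ n ∈ Finset.Icc 1 KT,
            α n * ((σ.choose t : ℝ) / KT.choose t + ((n : ℝ) - t) * s) := by
          have : ∀ n : ℕ, α n * ((σ.choose t : ℝ) / KT.choose t + ((n : ℝ) - t) * s) =
              α n * ((σ.choose t : ℝ) / KT.choose t - t * s) + n * α n * s := fun n => by ring
          simp only [this, Finset.sum_add_distrib, ← Finset.sum_mul, hsum, hmean]
          ring
      _ ≤ _ := Finset.sum_le_sum fun n hn =>
          mul_le_mul_of_nonneg_left (hs n (Finset.mem_Icc.1 hn).2) (hα n hn)
end

section
/- Let $K \ge 1$ be an integer, $f : \{1,\dots,K\} \to \mathbb{R}$ discrete convex (i.e., $f(n-1)+f(n+1) \ge 2f(n)$ for $2 \le n \le K-1$), and let $t$ be a real number with $1 \le t \le K$ that is not an integer; set $t_1 = \lfloor t \rfloor$ and $t_2 = t_1 + 1$. Then the minimum of $\sum_{n=1}^K \alpha_n f(n)$ over real weights $\alpha_n \ge 0$ with $\sum_{n=1}^K \alpha_n = 1$ and $\sum_{n=1}^K n\,\alpha_n = t$ equals the linear interpolation $(t_2 - t) f(t_1) + (t - t_1) f(t_2)$; in particular it is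 both a lower bound on the feasible set and attained by $\alpha_{t_1} = t_2 - t$, $\alpha_{t_2} = t - t_1$. -/
open Finset

/-- The increments of a discrete convex function on `{1,…,K}` are monotone. -/
theorem increment_le_increment {K : ℕ} {f : ℕ → ℝ}
    (hconv : ∀ n : ℕ, 2 ≤ n → n ≤ K - 1 → 2 * f n ≤ f (n - 1) + f (n + 1))
    {a b : ℕ} (ha : 1 ≤ a) (hab : a ≤ b) (hb : b + 1 ≤ K) :
    f (a + 1) - f a ≤ f (b + 1) - f b := by
  induction b, hab using Nat.le_induction with
  | base => exact le_rfl
  | succ b hab ih =>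
    have h := hconv (b + 1) (by omega) (by omega)
    have ih := ih (by omega)
    rw [Nat.add_sub_cancel] at h
    linarith

/-- A discrete convex function on `{1,…,K}` lies above the line through two consecutive points
of its graph. -/
theorem chord_le_of_discrete_convex {K : ℕ} {f : ℕ → ℝ}
    (hconv : ∀ n : ℕ, 2 ≤ n → n ≤ K - 1 → 2 * f n ≤ f (n - 1) + f (n + 1))
    {m n : ℕ} (hm : 1 ≤ m) (hmK : m + 1 ≤ K) (hn : 1 ≤ n) (hnK : n ≤ K) :
    f m + ((n : ℝ) - m) * (f (m + 1) - f m) ≤ f n := by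
  rcases le_total m n with hmn | hnm
  · induction n, hmn using Nat.le_induction with
    | base => simp
    | succ n hmn ih =>
      have ih := ih (by omega) (by omega)
      have h := increment_le_increment hconv hm hmn hnK
      push_cast
      linarith
  · induction hnm using Nat.decreasingInduction with
    | self => simp
    | of_succ n hnm ih =>
      have ih := ih (by omega) (by omega)
      have h := increment_le_increment hconv hn hnm.le hmK
      push_cast at ih
      linarith

/-- A sum over `{1,…,K}` of a function supported on two consecutive points. -/
theorem sum_Icc_eq_add_of_consecutive {K m : ℕ} (hm : 1 ≤ m) (hmK : m + 1 ≤ K) (g : ℕ → ℝ)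
    (hg : ∀ n, n ≠ m → n ≠ m + 1 → g n = 0) :
    ∑ n ∈ Finset.Icc 1 K, g n = g m + g (m + 1) := by
  rw [← Finset.sum_pair (Nat.succ_ne_self m).symm]
  symm
  apply Finset.sum_subset
  · intro n hn
    simp only [Finset.mem_insert, Finset.mem_singleton] at hn
    rw [Finset.mem_Icc]
    omega
  · intro n _ hn
    simp only [Finset.mem_insert, Finset.mem_singleton, not_or] at hn
    exact hg n hn.1 hn.2

/-- Let `K ≥ 1`, `f : {1,…,K} → ℝ` discrete convex, and `t ∈ [1, K]` a non-integer real
number; set `t₁ = ⌊t⌋` and `t₂ = t₁ + 1`. The minimum of `∑ₙ αₙ f(n)` over nonnegative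
weights with `∑ αₙ = 1` and `∑ n αₙ = t` equals the linear interpolation
`(t₂ - t) f(t₁) + (t - t₁) f(t₂)`: it is a lower bound on the feasible set and is
attained by `α_{t₁} = t₂ - t`, `α_{t₂} = t - t₁`. -/
theorem placement_opt_noninteger (K : ℕ) (hK : 1 ≤ K) (f : ℕ → ℝ)
    (hconv : ∀ n : ℕ, 2 ≤ n → n ≤ K - 1 → 2 * f n ≤ f (n - 1) + f (n + 1))
    (t : ℝ) (ht1 : 1 ≤ t) (ht2 : t ≤ K) (hnotint : ¬∃ m : ℤ, t = (m : ℝ)) :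
    IsLeast {x : ℝ | ∃ α : ℕ → ℝ,
        (∀ n ∈ Finset.Icc 1 K, 0 ≤ α n) ∧
        (∑ n ∈ Finset.Icc 1 K, α n) = 1 ∧
        (∑ n ∈ Finset.Icc 1 K, (n : ℝ) * α n) = t ∧
        x = ∑ n ∈ Finset.Icc 1 K, α n * f n}
      (((⌊t⌋₊ : ℝ) + 1 - t) * f ⌊t⌋₊ + (t - (⌊t⌋₊ : ℝ)) * f (⌊t⌋₊ + 1)) := by
  have hle : (⌊t⌋₊ : ℝ) ≤ t := Nat.floor_le (by linarith)
  have hlt : t < (⌊t⌋₊ : ℝ) + 1 := Nat.lt_floor_add_one t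
  have hm : 1 ≤ ⌊t⌋₊ := Nat.one_le_floor_iff t |>.mpr ht1
  have hne : (⌊t⌋₊ : ℝ) ≠ t := fun h => hnotint ⟨⌊t⌋₊, by exact_mod_cast h.symm⟩
  have hmK : ⌊t⌋₊ + 1 ≤ K := by
    have : (⌊t⌋₊ : ℝ) < K := (lt_of_le_of_ne hle hne).trans_le ht2
    exact_mod_cast this
  generalize ⌊t⌋₊ = m at *
  constructor
  · refine ⟨fun n => if n = m then (m : ℝ) + 1 - t else if n = m + 1 then t - m else 0,
      ?_, ?_, ?_, ?_⟩
    · intro n _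
      dsimp only
      split_ifs <;> linarith
    · rw [sum_Icc_eq_add_of_consecutive hm hmK _ (fun n h₁ h₂ => by simp [h₁, h₂])]
      simp
    · rw [sum_Icc_eq_add_of_consecutive hm hmK _ (fun n h₁ h₂ => by simp [h₁, h₂])]
      simp
      ring
    · rw [sum_Icc_eq_add_of_consecutive hm hmK _ (fun n h₁ h₂ => by simp [h₁, h₂])]
      simp
  · rintro x ⟨α, hα, hsum, hmean, rfl⟩
    calc ((m : ℝ) + 1 - t) * f m + (t - m) * f (m + 1)
        = (f m - m * (f (m + 1) - f m)) * ∑ n ∈ Finset.Icc 1 K, α n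
          + (f (m + 1) - f m) * ∑ n ∈ Finset.Icc 1 K, (n : ℝ) * α n := by
          rw [hsum, hmean]
          ring
      _ = ∑ n ∈ Finset.Icc 1 K, α n * (f m + ((n : ℝ) - m) * (f (m + 1) - f m)) := by
          rw [Finset.mul_sum, Finset.mul_sum, ← Finset.sum_add_distrib]
          exact Finset.sum_congr rfl fun n _ => by ring
      _ ≤ ∑ n ∈ Finset.Icc 1 K, α n * f n := by
          refine Finset.sum_le_sum fun n hn => mul_le_mul_of_nonneg_left ?_ (hα n hn)
          rw [Finset.mem_Icc] at hn
          exact chord_le_of_discrete_convex hconv hm hmK hn.1 hn.2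
end
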